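/- Let q ≥ 1 with Hölder conjugate p (1/p + 1/q = 1, with p = ∞ when q = 1), let R_1,…,R_n ∈ ℝ^d, let φ ∈ ℝ^d with Σ_{i=1}^d φ_i = 1, let δ > 0 and α ∈ ℝ with (α − ⟨φ, E_{P_n}[R]⟩)² ≤ δ ‖φ‖_p². Then sup { E_P[⟨φ,R⟩²] : P a Borel probability measure on ℝ^d with finite second moments, D_c(P,P_n) ≤ δ, E_P[⟨φ,R⟩] = α } = E_{P_n}[⟨φ,R⟩²] + 2(α − ⟨φ, E_{P_n}[R]⟩)·⟨φ, E_{P_n}[R]⟩ + δ‖φ‖_p² + 2 √( δ‖φ‖_p² − (α − ⟨φ, E_{P_n}[R]⟩)² ) · √( Var_{P_n}(⟨φ,R⟩) ), where Var_{P_n}(⟨φ,R⟩) = E_{P_n}[⟨φ,R⟩²] − (⟨φ, E_{P_n}[R]⟩)². -/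

import Mathlib

open MeasureTheory ENNReal NNReal Filter Topology

noncomputable section

/-- The `l_p` norm on `ℝ^d`, for an extended exponent `p` (sup-norm when `p = ∞`). -/
def lpNorm {d : ℕ} (p : ℝ≥0∞) (x : Fin d → ℝ) : ℝ :=
  if p = ∞ then ⨆ i, |x i| else (∑ i, |x i| ^ p.toReal) ^ (1 / p.toReal)

/-- `p ∈ [1,∞]` is the Hölder conjugate of `q ∈ [1,∞)`: `1/p + 1/q = 1`,
with `p = ∞` when `q = 1`. -/
def HolderConjugate (q : ℝ) (p : ℝ≥0∞) : Prop :=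
  (q = 1 ∧ p = ∞) ∨ (1 < q ∧ p ≠ ∞ ∧ 1 / p.toReal + 1 / q = 1)

/-- The optimal transport discrepancy between two Borel probability measures on `ℝ^d`
associated with a cost function `c`. -/
def Dc {d : ℕ} (c : (Fin d → ℝ) → (Fin d → ℝ) → ℝ≥0∞)
    (P Q : Measure (Fin d → ℝ)) : ℝ≥0∞ :=
  ⨅ (π : Measure ((Fin d → ℝ) × (Fin d → ℝ))) (_ : IsProbabilityMeasure π)
    (_ : π.map Prod.fst = P) (_ : π.map Prod.snd = Q), ∫⁻ x, c x.1 x.2 ∂π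

/-- The quadratic `l_q` transport cost `c(u,w) = ‖u - w‖_q²`. -/
def costQ {d : ℕ} (q : ℝ) (u w : Fin d → ℝ) : ℝ≥0∞ :=
  ENNReal.ofReal (lpNorm (ENNReal.ofReal q) (u - w) ^ 2)

/-- The empirical measure `P_n = (1/n) ∑_{i=1}^n δ_{R_i}`. -/
def empMeasure {d n : ℕ} (R : Fin n → Fin d → ℝ) : Measure (Fin d → ℝ) :=
  (n : ℝ≥0∞)⁻¹ • ∑ i : Fin n, Measure.dirac (R i)

/-- Weak convergence of a sequence of measures, expressed via integration of
bounded continuous functions. -/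
def WeakConv {E : Type*} [TopologicalSpace E] [MeasurableSpace E]
    (μs : ℕ → Measure E) (ν : Measure E) : Prop :=
  ∀ f : BoundedContinuousFunction E ℝ,
    Tendsto (fun n => ∫ x, f x ∂(μs n)) atTop (𝓝 (∫ x, f x ∂ν))

theorem HolderConjugate.toReal_holderConjugate {q : ℝ} {p : ℝ≥0∞} (h : HolderConjugate q p)
    (hp : p ≠ ∞) : p.toReal.HolderConjugate q := by
  rcases h with ⟨_, h⟩ | ⟨hq, _, h⟩
  · exact absurd h hp
  · refine (Real.holderConjugate_iff.2 ⟨hq, ?_⟩).symm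
    rw [one_div, one_div] at h
    linarith

theorem HolderConjugate.eq_one {q : ℝ} (h : HolderConjugate q ∞) : q = 1 := by
  rcases h with ⟨h, _⟩ | ⟨_, h, _⟩
  · exact h
  · exact absurd rfl h

theorem lpNorm_nonneg {d : ℕ} (p : ℝ≥0∞) (x : Fin d → ℝ) : 0 ≤ lpNorm p x := by
  unfold _root_.lpNorm
  split_ifs
  · exact Real.iSup_nonneg fun i => abs_nonneg _
  · positivity

theorem lpNorm_ofReal {d : ℕ} {q : ℝ} (hq : 0 ≤ q) (x : Fin d → ℝ) :
    lpNorm (ENNReal.ofReal q) x = (∑ i, |x i| ^ q) ^ (1 / q) := by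
  simp [_root_.lpNorm, ENNReal.toReal_ofReal hq]

theorem lpNorm_ofReal_smul {d : ℕ} {q : ℝ} (hq : 1 ≤ q) (c : ℝ) (x : Fin d → ℝ) :
    lpNorm (ENNReal.ofReal q) (c • x) = |c| * lpNorm (ENNReal.ofReal q) x := by
  have hq0 : 0 < q := by linarith
  rw [lpNorm_ofReal hq0.le, lpNorm_ofReal hq0.le]
  have h : ∑ i, |(c • x) i| ^ q = |c| ^ q * ∑ i, |x i| ^ q := by
    rw [Finset.mul_sum]
    refine Finset.sum_congr rfl fun i _ => ?_
    rw [Pi.smul_apply, smul_eq_mul, abs_mul, Real.mul_rpow (abs_nonneg _) (abs_nonneg _)]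
  rw [h, Real.mul_rpow (by positivity) (by positivity), ← Real.rpow_mul (abs_nonneg _),
    mul_one_div_cancel hq0.ne', Real.rpow_one]

/-- Hölder's inequality for the pairing of `l_p` and `l_q`. -/
theorem sum_mul_le_lpNorm_mul_lpNorm {d : ℕ} {q : ℝ} (hq : 1 ≤ q) {p : ℝ≥0∞}
    (hpq : HolderConjugate q p) (φ x : Fin d → ℝ) :
    ∑ i, φ i * x i ≤ lpNorm p φ * lpNorm (ENNReal.ofReal q) x := by
  rw [lpNorm_ofReal (by linarith)]
  by_cases hp : p = ∞
  · subst hp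
    obtain rfl := hpq.eq_one
    simp only [_root_.lpNorm, if_true, Real.rpow_one, div_one]
    rw [Finset.mul_sum]
    refine Finset.sum_le_sum fun i _ => (le_abs_self _).trans ?_
    rw [abs_mul]
    gcongr
    exact le_ciSup (f := fun i => |φ i|) (Set.finite_range _).bddAbove i
  · simp only [_root_.lpNorm, if_neg hp]
    exact Real.inner_le_Lp_mul_Lq _ _ _ (hpq.toReal_holderConjugate hp)

theorem sq_sum_mul_le_lpNorm {d : ℕ} {q : ℝ} (hq : 1 ≤ q) {p : ℝ≥0∞}
    (hpq : HolderConjugate q p) (φ x : Fin d → ℝ) :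
    (∑ i, φ i * x i) ^ 2 ≤ lpNorm p φ ^ 2 * lpNorm (ENNReal.ofReal q) x ^ 2 := by
  rw [← mul_pow]
  refine sq_le_sq' ?_ (sum_mul_le_lpNorm_mul_lpNorm hq hpq φ x)
  have h := sum_mul_le_lpNorm_mul_lpNorm hq hpq φ ((-1 : ℝ) • x)
  rw [lpNorm_ofReal_smul hq, abs_neg, abs_one, one_mul] at h
  simp only [Pi.smul_apply, smul_eq_mul, neg_mul, one_mul, mul_neg, Finset.sum_neg_distrib] at h
  linarith

theorem lpNorm_pos {d : ℕ} {q : ℝ} (hq : 1 ≤ q) {p : ℝ≥0∞}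
    (hpq : HolderConjugate q p) {φ : Fin d → ℝ} (hφ : φ ≠ 0) : 0 < lpNorm p φ := by
  refine (lpNorm_nonneg p φ).lt_of_ne fun h => hφ ?_
  have hs := sum_mul_le_lpNorm_mul_lpNorm hq hpq φ φ
  rw [← h, zero_mul] at hs
  have h0 := (Finset.sum_eq_zero_iff_of_nonneg fun i _ => mul_self_nonneg (φ i)).1
    (hs.antisymm (Finset.sum_nonneg fun i _ => mul_self_nonneg (φ i)))
  funext i
  simpa using h0 i (Finset.mem_univ i)

/-- The `l_p` norm is attained as a dual norm. -/
theorem exists_lpNorm_eq_one_sum_mul_eq {d : ℕ} {q : ℝ} (hq : 1 ≤ q) {p : ℝ≥0∞}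
    (hpq : HolderConjugate q p) {φ : Fin d → ℝ} (hφ : φ ≠ 0) :
    ∃ e : Fin d → ℝ, lpNorm (ENNReal.ofReal q) e = 1 ∧ ∑ i, φ i * e i = lpNorm p φ := by
  have hN := lpNorm_pos hq hpq hφ
  by_cases hp : p = ∞
  · subst hp
    obtain rfl := hpq.eq_one
    have : Nonempty (Fin d) := by
      by_contra h
      rw [not_nonempty_iff] at h
      exact hφ (Subsingleton.elim _ _)
    obtain ⟨j, hj⟩ := exists_eq_ciSup_of_finite (f := fun i => |φ i|)
    have hj' : |φ j| = lpNorm ∞ φ := by simpa [_root_.lpNorm] using hj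
    have hj0 : φ j ≠ 0 := abs_pos.1 (hj' ▸ hN)
    refine ⟨Pi.single j (SignType.sign (φ j) : ℝ), ?_, ?_⟩
    · rw [lpNorm_ofReal zero_le_one]
      simp only [Real.rpow_one, div_one]
      rw [Finset.sum_eq_single j]
      · rcases lt_or_gt_of_ne hj0 with h | h <;> simp [h]
      · intro i _ hi
        simp [hi]
      · simp
    · rw [Finset.sum_eq_single j]
      · rw [Pi.single_eq_same, self_mul_sign, hj']
      · intro i _ hi
        simp [hi]
      · simp
  · have hc := hpq.toReal_holderConjugate hp
    set r := p.toReal with hr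
    set N := lpNorm p φ with hNdef
    have hr0 : 0 < r := hc.pos
    have hNr : ∑ i, |φ i| ^ r = N ^ r := by
      simp only [hNdef, _root_.lpNorm, if_neg hp]
      rw [← Real.rpow_mul (by positivity), one_div_mul_cancel hr0.ne', Real.rpow_one]
    have hNN : N ^ r = N * N ^ (r - 1) := by
      rw [Real.rpow_sub_one hN.ne']
      field_simp
    have hNp : 0 < N ^ (r - 1) := Real.rpow_pos_of_pos hN _
    refine ⟨fun i => SignType.sign (φ i) * |φ i| ^ (r - 1) / N ^ (r - 1), ?_, ?_⟩
    · rw [lpNorm_ofReal (by linarith)]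
      have hterm : ∀ i, |(SignType.sign (φ i) : ℝ) * |φ i| ^ (r - 1) / N ^ (r - 1)| ^ q
          = |φ i| ^ r / N ^ r := by
        intro i
        have hmul : (r - 1) * q = r := hc.sub_one_mul_conj
        rcases eq_or_ne (φ i) 0 with h | h
        · simp [h, hr0.ne', (show q ≠ 0 by linarith)]
        · have hs : |(SignType.sign (φ i) : ℝ)| = 1 := by
            rcases lt_or_gt_of_ne h with h | h <;> simp [h]
          rw [abs_div, abs_mul, hs, one_mul, abs_of_pos hNp, abs_of_nonneg (by positivity),
            Real.div_rpow (by positivity) hNp.le, ← Real.rpow_mul (abs_nonneg _),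
            ← Real.rpow_mul hN.le, hmul]
      simp only [hterm]
      rw [← Finset.sum_div, hNr, div_self (Real.rpow_pos_of_pos hN _).ne', Real.one_rpow]
    · have hterm : ∀ i, φ i * ((SignType.sign (φ i) : ℝ) * |φ i| ^ (r - 1) / N ^ (r - 1))
          = |φ i| ^ r / N ^ (r - 1) := by
        intro i
        rw [← mul_div_assoc, ← mul_assoc, self_mul_sign]
        rcases eq_or_ne (φ i) 0 with h | h
        · simp [h, hr0.ne']
        · rw [Real.rpow_sub_one (abs_pos.2 h).ne', mul_div_cancel₀ _ (abs_pos.2 h).ne']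
      simp only [hterm]
      rw [← Finset.sum_div, hNr, hNN, mul_div_assoc, div_self hNp.ne', mul_one]

/-- Cauchy–Schwarz bound for the second moment of `f` in terms of a reference variable `g`. -/
theorem integral_sq_le_of_integral_sub_sq_le {Ω : Type*} [MeasurableSpace Ω] {μ : Measure Ω}
    [IsProbabilityMeasure μ] {f g : Ω → ℝ} (hf : MemLp f 2 μ) (hg : MemLp g 2 μ)
    {α m1 m2 K : ℝ} (hα : ∫ x, f x ∂μ = α) (hm1 : ∫ x, g x ∂μ = m1)
    (hm2 : ∫ x, g x ^ 2 ∂μ = m2) (hK : ∫ x, (f x - g x) ^ 2 ∂μ ≤ K) :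
    ∫ x, f x ^ 2 ∂μ ≤ m2 + 2 * (α - m1) * m1 + K +
      2 * Real.sqrt (K - (α - m1) ^ 2) * Real.sqrt (m2 - m1 ^ 2) := by
  have if1 : Integrable f μ := hf.integrable (by norm_num)
  have ig1 : Integrable g μ := hg.integrable (by norm_num)
  have if2 : Integrable (fun x => f x ^ 2) μ := hf.integrable_sq
  have ig2 : Integrable (fun x => g x ^ 2) μ := hg.integrable_sq
  have ifg : Integrable (fun x => f x * g x) μ := hf.integrable_mul hg
  have combine : ∀ a b c u v w : ℝ,
      ∫ x, (a * f x ^ 2 + b * (f x * g x) + c * g x ^ 2 + (u * f x + v * g x + w)) ∂μ =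
        a * ∫ x, f x ^ 2 ∂μ + b * ∫ x, f x * g x ∂μ + c * m2 + (u * α + v * m1 + w) := by
    intro a b c u v w
    rw [integral_add (by fun_prop) (by fun_prop), integral_add (by fun_prop) (by fun_prop),
      integral_add (by fun_prop) (by fun_prop), integral_add (by fun_prop) (by fun_prop),
      integral_add (by fun_prop) (by fun_prop)]
    simp only [integral_const_mul, hα, hm1, hm2]
    simp
  set F := ∫ x, f x ^ 2 ∂μ
  set G := ∫ x, f x * g x ∂μ
  have hh : ∫ x, (f x - g x) ^ 2 ∂μ = F - 2 * G + m2 := by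
    have := combine 1 (-2) 1 0 0 0
    rw [show F - 2 * G + m2 = 1 * F + -2 * G + 1 * m2 + (0 * α + 0 * m1 + 0) by ring, ← this]
    congr 1
    ext x
    ring
  rw [hh] at hK
  have hquad : ∀ t : ℝ, 0 ≤ (m2 - m1 ^ 2) * (t * t) +
      (2 * (G - m2 - (α - m1) * m1)) * t + (F - 2 * G + m2 - (α - m1) ^ 2) := by
    intro t
    have h0 : 0 ≤ ∫ x, (f x - g x - (α - m1) + t * (g x - m1)) ^ 2 ∂μ :=
      integral_nonneg fun x => sq_nonneg _
    have h1 := combine 1 (2 * (t - 1)) ((t - 1) ^ 2) (-2 * (α - m1 + t * m1))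
      (-2 * (t - 1) * (α - m1 + t * m1)) ((α - m1 + t * m1) ^ 2)
    have h2 := h0.trans_eq ((integral_congr_ae (ae_of_all μ fun x => by ring)).trans h1)
    linarith
  have hd := discrim_le_zero hquad
  unfold discrim at hd
  have hA : 0 ≤ F - 2 * G + m2 - (α - m1) ^ 2 := by simpa using hquad 0
  have hB : 0 ≤ m2 - m1 ^ 2 := by
    have h0 : 0 ≤ ∫ x, (g x - m1) ^ 2 ∂μ := integral_nonneg fun x => sq_nonneg _
    have h2 := h0.trans_eq ((integral_congr_ae (ae_of_all μ fun x => by ring)).trans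
      (combine 0 0 1 0 (-2 * m1) (m1 ^ 2)))
    linarith
  have hcov : G - m2 - (α - m1) * m1 ≤
      Real.sqrt (K - (α - m1) ^ 2) * Real.sqrt (m2 - m1 ^ 2) := by
    rw [← Real.sqrt_mul (by linarith)]
    refine Real.le_sqrt_of_sq_le ?_
    nlinarith [mul_le_mul_of_nonneg_right hK hB]
  linarith

/-- The uniform probability measure on a finite family of points. -/
def uniformMeasure {κ E : Type*} [Fintype κ] [MeasurableSpace E] (X : κ → E) : Measure E :=
  (Fintype.card κ : ℝ≥0∞)⁻¹ • ∑ k, Measure.dirac (X k)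

section uniformMeasure

variable {κ E F : Type*} [Fintype κ] [MeasurableSpace E] [MeasurableSpace F]

theorem isProbabilityMeasure_uniformMeasure [Nonempty κ] (X : κ → E) :
    IsProbabilityMeasure (uniformMeasure X) := by
  refine ⟨?_⟩
  simp [uniformMeasure, ENNReal.inv_mul_cancel]

theorem map_uniformMeasure {f : E → F} (hf : Measurable f) (X : κ → E) :
    (uniformMeasure X).map f = uniformMeasure (fun k => f (X k)) := by
  simp only [uniformMeasure, Measure.map_smul]
  rw [Measure.map_finset_sum' hf.aemeasurable]
  simp only [Measure.map_dirac' hf]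

theorem integrable_uniformMeasure [Nonempty κ] [MeasurableSingletonClass E] (X : κ → E)
    (f : E → ℝ) : Integrable f (uniformMeasure X) := by
  refine Integrable.smul_measure ?_ (by simp)
  exact integrable_finsetSum_measure.2 fun k _ => integrable_dirac (by simp)

theorem integral_uniformMeasure [MeasurableSingletonClass E] (X : κ → E) (f : E → ℝ) :
    ∫ x, f x ∂uniformMeasure X = (1 / Fintype.card κ : ℝ) * ∑ k, f (X k) := by
  rw [uniformMeasure, integral_smul_measure,
    integral_finsetSum_measure fun k _ => integrable_dirac (by simp)]
  simp

theorem lintegral_ofReal_uniformMeasure [Nonempty κ] [MeasurableSingletonClass E] (X : κ → E)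
    {f : E → ℝ} (hf : ∀ x, 0 ≤ f x) : ∫⁻ x, ENNReal.ofReal (f x) ∂uniformMeasure X =
      ENNReal.ofReal ((1 / Fintype.card κ : ℝ) * ∑ k, f (X k)) := by
  rw [← ofReal_integral_eq_lintegral_ofReal (integrable_uniformMeasure X f)
    (ae_of_all _ hf), integral_uniformMeasure]

end uniformMeasure

theorem empMeasure_eq_uniformMeasure {d n : ℕ} (R : Fin n → Fin d → ℝ) :
    empMeasure R = uniformMeasure R := by
  simp [empMeasure, uniformMeasure]

theorem uniformMeasure_comp_fst {κ E : Type*} [Fintype κ] [MeasurableSpace E] (X : κ → E) :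
    uniformMeasure (fun k : κ × Bool => X k.1) = uniformMeasure X := by
  simp only [uniformMeasure, Fintype.sum_prod_type, Fintype.sum_bool, Fintype.card_prod,
    Fintype.card_bool, ← two_nsmul]
  rw [← Finset.smul_sum, ← Nat.cast_smul_eq_nsmul ℝ≥0∞, smul_smul]
  congr 1
  push_cast
  rw [ENNReal.mul_inv (by simp) (by simp), mul_assoc, ENNReal.inv_mul_cancel (by simp) (by simp),
    mul_one]

/-- A centred perturbation of prescribed variance and maximal covariance with `y`, after
splitting every atom into two. -/
theorem exists_centred_perturbation {n : ℕ} (hn : 0 < n) (y : Fin n → ℝ) (s : ℝ) {m1 m2 : ℝ}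
    (hm1 : m1 = (1 / n : ℝ) * ∑ i, y i) (hm2 : m2 = (1 / n : ℝ) * ∑ i, y i ^ 2) :
    ∃ a : Fin n × Bool → ℝ, ∑ k, a k = 0 ∧ ∑ k, a k ^ 2 = 2 * n * s ^ 2 ∧
      ∑ k, y k.1 * a k = 2 * n * (s * Real.sqrt (m2 - m1 ^ 2)) := by
  have hn0 : (n : ℝ) ≠ 0 := by positivity
  have hy1 : ∑ i, y i = n * m1 := by rw [hm1]; field_simp
  have hy2 : ∑ i, y i ^ 2 = n * m2 := by rw [hm2]; field_simp
  rcases lt_or_ge 0 (m2 - m1 ^ 2) with hV | hV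
  · set v := Real.sqrt (m2 - m1 ^ 2)
    have hv : 0 < v := Real.sqrt_pos.2 hV
    have hvv : v ^ 2 = m2 - m1 ^ 2 := Real.sq_sqrt hV.le
    have hc : ∑ i, (y i - m1) = 0 := by simp [Finset.sum_sub_distrib, hy1]
    have hyc : ∑ i, y i * (y i - m1) = n * v ^ 2 := by
      have : ∀ i, y i * (y i - m1) = y i ^ 2 - y i * m1 := fun i => by ring
      simp only [this, Finset.sum_sub_distrib, ← Finset.sum_mul, hy1, hy2, hvv]
      ring
    have hcc : ∑ i, (y i - m1) ^ 2 = n * v ^ 2 := by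
      have : ∀ i, (y i - m1) ^ 2 = y i * (y i - m1) - m1 * (y i - m1) := fun i => by ring
      rw [Finset.sum_congr rfl fun i _ => this i, Finset.sum_sub_distrib, ← Finset.mul_sum, hyc, hc,
        mul_zero, sub_zero]
    refine ⟨fun k => s / v * (y k.1 - m1), ?_, ?_, ?_⟩
    · simp only [Fintype.sum_prod_type, Fintype.sum_bool, ← two_mul, ← Finset.mul_sum, hc,
        mul_zero]
    · simp only [Fintype.sum_prod_type, Fintype.sum_bool, ← two_mul, mul_pow, ← Finset.mul_sum, hcc]
      field_simp
    · simp only [Fintype.sum_prod_type, Fintype.sum_bool, ← two_mul, mul_left_comm (y _),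
        ← Finset.mul_sum, hyc]
      field_simp
  · rw [Real.sqrt_eq_zero_of_nonpos hV]
    refine ⟨fun k => if k.2 then s else -s, ?_, ?_, ?_⟩
    · simp [Fintype.sum_prod_type]
    · simp only [ite_pow, neg_sq, ite_self, Finset.sum_const, Finset.card_univ, Fintype.card_prod,
        Fintype.card_fin, Fintype.card_bool, nsmul_eq_mul]
      push_cast
      ring
    · simp [Fintype.sum_prod_type]

theorem memLp_two_sum_mul {d : ℕ} {P : Measure (Fin d → ℝ)}
    (hP : Integrable (fun r => ‖r‖ ^ 2) P) (φ : Fin d → ℝ) :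
    MemLp (fun r : Fin d → ℝ => ∑ i, φ i * r i) 2 P := by
  have hid : MemLp (fun r : Fin d → ℝ => r) 2 P :=
    (memLp_two_iff_integrable_sq_norm measurable_id.aestronglyMeasurable).2 hP
  refine memLp_finsetSum _ fun i _ => ?_
  exact (MemLp.eval hid i).const_mul (φ i)

/-- The second moment of a measure with mean level `α` is bounded by the worst-case value
associated with any strict upper bound of its transport discrepancy. -/
theorem integral_sq_le_of_Dc_lt {d n : ℕ} (hn : 0 < n) {q : ℝ} (hq : 1 ≤ q) {p : ℝ≥0∞}
    (hpq : HolderConjugate q p) (R : Fin n → Fin d → ℝ) (φ : Fin d → ℝ) {δ α m1 m2 : ℝ}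
    (hδ : 0 ≤ δ) (hm1 : m1 = (1 / n : ℝ) * ∑ i, ∑ j, φ j * R i j)
    (hm2 : m2 = (1 / n : ℝ) * ∑ i, (∑ j, φ j * R i j) ^ 2)
    {P : Measure (Fin d → ℝ)} (hP : Integrable (fun r => ‖r‖ ^ 2) P)
    (hD : Dc (costQ q) P (empMeasure R) < ENNReal.ofReal δ)
    (hα : ∫ r, ∑ i, φ i * r i ∂P = α) :
    ∫ r, (∑ i, φ i * r i) ^ 2 ∂P ≤ m2 + 2 * (α - m1) * m1 + δ * lpNorm p φ ^ 2 +
      2 * Real.sqrt (δ * lpNorm p φ ^ 2 - (α - m1) ^ 2) * Real.sqrt (m2 - m1 ^ 2) := by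
  have : Nonempty (Fin n) := ⟨⟨0, hn⟩⟩
  simp only [Dc, iInf_lt_iff] at hD
  obtain ⟨π, hπ, h1, h2, hcost⟩ := hD
  rw [empMeasure_eq_uniformMeasure] at h2
  have hL := memLp_two_sum_mul hP φ
  have hR := memLp_two_sum_mul (integrable_uniformMeasure R fun r => ‖r‖ ^ 2) φ
  have hmeas : Measurable fun r : Fin d → ℝ => ∑ i, φ i * r i := by fun_prop
  have hf : MemLp (fun x : (Fin d → ℝ) × (Fin d → ℝ) => ∑ i, φ i * x.1 i) 2 π := by
    rw [← h1] at hL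
    exact hL.comp_of_map measurable_fst.aemeasurable
  have hg : MemLp (fun x : (Fin d → ℝ) × (Fin d → ℝ) => ∑ i, φ i * x.2 i) 2 π := by
    rw [← h2] at hR
    exact hR.comp_of_map measurable_snd.aemeasurable
  have hfst : ∀ u : (Fin d → ℝ) → ℝ, Measurable u → ∫ r, u r ∂P = ∫ x, u x.1 ∂π := by
    intro u hu
    rw [← h1, integral_map measurable_fst.aemeasurable hu.aestronglyMeasurable]
  have hsnd : ∀ u : (Fin d → ℝ) → ℝ, Measurable u →
      ∫ x, u x.2 ∂π = (1 / n : ℝ) * ∑ i, u (R i) := by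
    intro u hu
    rw [← integral_map measurable_snd.aemeasurable hu.aestronglyMeasurable, h2,
      integral_uniformMeasure, Fintype.card_fin]
  rw [hfst _ (hmeas.pow_const 2)]
  refine integral_sq_le_of_integral_sub_sq_le hf hg ((hfst _ hmeas).symm.trans hα)
    ((hsnd _ hmeas).trans hm1.symm) ((hsnd _ (hmeas.pow_const 2)).trans hm2.symm) ?_
  have hint : Integrable (fun x : (Fin d → ℝ) × (Fin d → ℝ) =>
      (∑ i, φ i * x.1 i - ∑ i, φ i * x.2 i) ^ 2) π := (hf.sub hg).integrable_sq
  rw [← ENNReal.ofReal_le_ofReal_iff (by positivity),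
    ofReal_integral_eq_lintegral_ofReal hint (ae_of_all _ fun x => sq_nonneg _)]
  calc ∫⁻ x, ENNReal.ofReal ((∑ i, φ i * x.1 i - ∑ i, φ i * x.2 i) ^ 2) ∂π
      ≤ ∫⁻ x, ENNReal.ofReal (lpNorm p φ ^ 2) * costQ q x.1 x.2 ∂π := by
        refine lintegral_mono fun x => ?_
        rw [costQ, ← ENNReal.ofReal_mul (sq_nonneg _)]
        refine ENNReal.ofReal_le_ofReal ?_
        refine le_trans (le_of_eq ?_) (sq_sum_mul_le_lpNorm hq hpq φ (x.1 - x.2))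
        simp only [Pi.sub_apply, mul_sub, Finset.sum_sub_distrib]
    _ = ENNReal.ofReal (lpNorm p φ ^ 2) * ∫⁻ x, costQ q x.1 x.2 ∂π :=
        lintegral_const_mul' _ _ ENNReal.ofReal_ne_top
    _ ≤ ENNReal.ofReal (lpNorm p φ ^ 2) * ENNReal.ofReal δ := by gcongr
    _ = ENNReal.ofReal (δ * lpNorm p φ ^ 2) := by
        rw [mul_comm, ENNReal.ofReal_mul hδ]

/-- A measure in the transport ball with mean level `α` attaining the worst-case value. -/
theorem exists_worstCase_measure {d n : ℕ} (hn : 0 < n) {q : ℝ} (hq : 1 ≤ q) {p : ℝ≥0∞}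
    (hpq : HolderConjugate q p) (R : Fin n → Fin d → ℝ) {φ : Fin d → ℝ} (hφ : φ ≠ 0)
    {δ α m1 m2 : ℝ} (hm1 : m1 = (1 / n : ℝ) * ∑ i, ∑ j, φ j * R i j)
    (hm2 : m2 = (1 / n : ℝ) * ∑ i, (∑ j, φ j * R i j) ^ 2)
    (hα : (α - m1) ^ 2 ≤ δ * lpNorm p φ ^ 2) :
    ∃ P : Measure (Fin d → ℝ), IsProbabilityMeasure P ∧ Integrable (fun r => ‖r‖ ^ 2) P ∧
      Dc (costQ q) P (empMeasure R) ≤ ENNReal.ofReal δ ∧ ∫ r, ∑ i, φ i * r i ∂P = α ∧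
      ∫ r, (∑ i, φ i * r i) ^ 2 ∂P = m2 + 2 * (α - m1) * m1 + δ * lpNorm p φ ^ 2 +
        2 * Real.sqrt (δ * lpNorm p φ ^ 2 - (α - m1) ^ 2) * Real.sqrt (m2 - m1 ^ 2) := by
  have : Nonempty (Fin n) := ⟨⟨0, hn⟩⟩
  have hn0 : (n : ℝ) ≠ 0 := by positivity
  have hN := lpNorm_pos hq hpq hφ
  obtain ⟨e, he1, heN⟩ := exists_lpNorm_eq_one_sum_mul_eq hq hpq hφ
  set N := lpNorm p φ
  obtain ⟨y, hy⟩ : ∃ y : Fin n → ℝ, ∀ i, ∑ j, φ j * R i j = y i := ⟨_, fun _ => rfl⟩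
  simp only [hy] at hm1 hm2
  set b := α - m1 with hb
  set s := Real.sqrt (δ * N ^ 2 - b ^ 2)
  have hss : s ^ 2 = δ * N ^ 2 - b ^ 2 := Real.sq_sqrt (by linarith)
  obtain ⟨a, ha1, ha2, hya⟩ := exists_centred_perturbation hn y s hm1 hm2
  have hy1 : ∑ i, y i = n * m1 := by rw [hm1]; field_simp
  have hy2 : ∑ i, y i ^ 2 = n * m2 := by rw [hm2]; field_simp
  set X : Fin n × Bool → Fin d → ℝ := fun k => R k.1 + ((b + a k) / N) • e with hX
  have hφX : ∀ k, ∑ i, φ i * X k i = y k.1 + b + a k := by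
    intro k
    simp only [hX, Pi.add_apply, Pi.smul_apply, smul_eq_mul, mul_add, Finset.sum_add_distrib,
      mul_left_comm (φ _), ← Finset.mul_sum, heN, hy]
    rw [div_mul_cancel₀ _ hN.ne', add_assoc]
  have hΔ : ∑ k, (b + a k) ^ 2 = 2 * n * (δ * N ^ 2) := by
    simp only [add_sq, Finset.sum_add_distrib, ← Finset.mul_sum, ha1, ha2, hss]
    simp
    ring
  have hyy : ∑ k : Fin n × Bool, y k.1 = 2 * n * m1 := by
    simp only [Fintype.sum_prod_type, Fintype.sum_bool, ← two_mul, ← Finset.mul_sum, hy1]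
    ring
  have hyy2 : ∑ k : Fin n × Bool, y k.1 ^ 2 = 2 * n * m2 := by
    simp only [Fintype.sum_prod_type, Fintype.sum_bool, ← two_mul, ← Finset.mul_sum, hy2]
    ring
  have hcard : (Fintype.card (Fin n × Bool) : ℝ) = n * 2 := by simp
  refine ⟨uniformMeasure X, isProbabilityMeasure_uniformMeasure X,
    integrable_uniformMeasure X _, ?_, ?_, ?_⟩
  · refine (iInf₂_le_of_le (uniformMeasure fun k => (X k, R k.1))
      (isProbabilityMeasure_uniformMeasure _) ?_)
    refine iInf₂_le_of_le (map_uniformMeasure measurable_fst _) ?_ ?_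
    · rw [map_uniformMeasure measurable_snd, empMeasure_eq_uniformMeasure]
      exact uniformMeasure_comp_fst R
    · simp only [costQ]
      rw [lintegral_ofReal_uniformMeasure (fun k => (X k, R k.1))
        (f := fun x => lpNorm (ENNReal.ofReal q) (x.1 - x.2) ^ 2) fun x => sq_nonneg _]
      refine ENNReal.ofReal_le_ofReal (le_of_eq ?_)
      have hterm : ∀ k, lpNorm (ENNReal.ofReal q) (X k - R k.1) ^ 2 = (b + a k) ^ 2 / N ^ 2 := by
        intro k
        rw [hX, add_sub_cancel_left, lpNorm_ofReal_smul hq, he1, mul_one, sq_abs, div_pow]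
      simp only [hterm]
      rw [← Finset.sum_div, hΔ, hcard]
      field_simp
  · rw [integral_uniformMeasure, hcard]
    simp only [hφX, Finset.sum_add_distrib, ha1, hyy]
    simp only [Finset.sum_const, Finset.card_univ, nsmul_eq_mul, hcard, hb]
    field_simp
    ring
  · rw [integral_uniformMeasure, hcard]
    have hterm : ∀ k, (y k.1 + b + a k) ^ 2 =
        y k.1 ^ 2 + 2 * b * y k.1 + 2 * (y k.1 * a k) + (b + a k) ^ 2 := fun k => by ring
    simp only [hφX, hterm, Finset.sum_add_distrib, ← Finset.mul_sum, hyy, hyy2, hya, hΔ]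
    field_simp
    ring

/-- Explicit value of the worst-case second moment over the
Wasserstein ball with a fixed mean level `α`. -/
theorem stmt5 {d n : ℕ} (hn : 0 < n) (q : ℝ) (hq : 1 ≤ q) (p : ℝ≥0∞)
    (hpq : HolderConjugate q p) (R : Fin n → Fin d → ℝ) (φ : Fin d → ℝ)
    (hφ : ∑ i, φ i = 1) (δ : ℝ) (hδ : 0 < δ) (α : ℝ) (m1 m2 : ℝ)
    (hm1 : m1 = (1 / n : ℝ) * ∑ i, ∑ j, φ j * R i j)
    (hm2 : m2 = (1 / n : ℝ) * ∑ i, (∑ j, φ j * R i j) ^ 2)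
    (hα : (α - m1) ^ 2 ≤ δ * lpNorm p φ ^ 2) :
    (⨆ (P : Measure (Fin d → ℝ)) (_ : IsProbabilityMeasure P)
        (_ : Integrable (fun r => ‖r‖ ^ 2) P)
        (_ : Dc (costQ q) P (empMeasure R) ≤ ENNReal.ofReal δ)
        (_ : ∫ r, ∑ i, φ i * r i ∂P = α),
        ((∫ r, (∑ i, φ i * r i) ^ 2 ∂P : ℝ) : EReal)) =
      ((m2 + 2 * (α - m1) * m1 + δ * lpNorm p φ ^ 2 +
          2 * Real.sqrt (δ * lpNorm p φ ^ 2 - (α - m1) ^ 2) *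
            Real.sqrt (m2 - m1 ^ 2) : ℝ) : EReal) := by
  have hφ0 : φ ≠ 0 := by
    rintro rfl
    simp at hφ
  refine le_antisymm ?_ ?_
  · refine iSup_le fun P => iSup_le fun _ => iSup_le fun hP => iSup_le fun hD =>
      iSup_le fun hmean => ?_
    rw [EReal.coe_le_coe_iff]
    have hcont : Continuous fun t : ℝ => m2 + 2 * (α - m1) * m1 + t * lpNorm p φ ^ 2 +
        2 * Real.sqrt (t * lpNorm p φ ^ 2 - (α - m1) ^ 2) * Real.sqrt (m2 - m1 ^ 2) := by
      fun_prop
    refine ge_of_tendsto ((hcont.tendsto δ).mono_left (nhdsWithin_le_nhds (s := Set.Ioi δ))) ?_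
    filter_upwards [self_mem_nhdsWithin] with t ht
    have ht' : δ < t := ht
    exact integral_sq_le_of_Dc_lt hn hq hpq R φ (hδ.trans ht').le hm1 hm2 hP
      (hD.trans_lt ((ENNReal.ofReal_lt_ofReal_iff (hδ.trans ht')).2 ht')) hmean
  · obtain ⟨P, h1, h2, h3, h4, h5⟩ := exists_worstCase_measure hn hq hpq R hφ0 hm1 hm2 hα
    rw [← h5]
    exact le_iSup_of_le P <| le_iSup_of_le h1 <| le_iSup_of_le h2 <| le_iSup_of_le h3 <|
      le_iSup_of_le h4 le_rfl
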